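/- Let R = ℝ[X, Y, Z]/(X² + Y² + Z² − 1) be the coordinate ring of the real 2-sphere. Then the R-module Der_ℝ(R) of ℝ-linear derivations of R is a finitely generated projective R-module, but it is not a free R-module. -/

import Mathlib

open MvPolynomial

/-- The coordinate ring `ℝ[X, Y, Z]/(X² + Y² + Z² − 1)` of the real 2-sphere. -/
abbrev SphereRing : Type :=
  MvPolynomial (Fin 3) ℝ ⧸
    Ideal.span {(X 0 : MvPolynomial (Fin 3) ℝ) ^ 2 + X 1 ^ 2 + X 2 ^ 2 - 1}

namespace Complex

/-- Two continuous logarithms of the same function on a connected space differ by a constant. -/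
theorem sub_eq_sub_of_exp_comp_eq {A : Type*} [TopologicalSpace A] [PreconnectedSpace A]
    {f g : A → ℂ} (hf : Continuous f) (hg : Continuous g) (h : ∀ a, exp (f a) = exp (g a))
    (a b : A) : f a - g a = f b - g b := by
  have key : f = fun x ↦ g x + (f a - g a) := by
    refine isCoveringMap_exp.eq_of_comp_eq hf (by fun_prop) ?_ a (by ring)
    ext x
    simp [exp_add, exp_sub, h]
  linear_combination -(congrFun key b)

/-- A homotopy of loops in `ℂ \ {0}` cannot join a loop of winding number `-1` to a loop of
winding number `1`. -/
theorem not_exists_homotopy_exp_neg_exp {g : ℝ × ℝ → ℂ} (hg : Continuous g)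
    (h₀ : ∀ p, g p ≠ 0) (hper : ∀ s t, g (s, t + 2 * Real.pi) = g (s, t)) {s₀ s₁ : ℝ} {c d : ℂ}
    (hc : ∀ t : ℝ, g (s₀, t) = c * exp (-(t * I))) (hd : ∀ t : ℝ, g (s₁, t) = d * exp (t * I)) :
    False := by
  obtain ⟨F, ⟨-, hF⟩, -⟩ := isCoveringMapOn_exp.existsUnique_continuousMap_lifts ⟨g, hg⟩
    (a₀ := ((0, 0) : ℝ × ℝ)) (exp_log (h₀ _)) (fun p ↦ h₀ p)
  replace hF (p) : exp (F p) = g p := congrFun hF p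
  have hc₀ : c ≠ 0 := fun h ↦ h₀ (s₀, 0) (by simp [hc, h])
  have hd₀ : d ≠ 0 := fun h ↦ h₀ (s₁, 0) (by simp [hd, h])
  have shift := sub_eq_sub_of_exp_comp_eq (f := fun p : ℝ × ℝ ↦ F (p.1, p.2 + 2 * Real.pi))
    (by fun_prop) F.continuous (fun p ↦ by simp [hF, hper]) (s₀, 0) (s₁, 0)
  have left := sub_eq_sub_of_exp_comp_eq (f := fun t : ℝ ↦ F (s₀, t))
    (g := fun t : ℝ ↦ log c + -(t * I)) (by fun_prop) (by fun_prop)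
    (fun t ↦ by rw [hF, hc, exp_add, exp_log hc₀]) 0 (2 * Real.pi)
  have right := sub_eq_sub_of_exp_comp_eq (f := fun t : ℝ ↦ F (s₁, t))
    (g := fun t : ℝ ↦ log d + t * I) (by fun_prop) (by fun_prop)
    (fun t ↦ by rw [hF, hd, exp_add, exp_log hd₀]) 0 (2 * Real.pi)
  simp only [zero_add] at shift
  push_cast at left right
  have : 4 * (Real.pi : ℂ) * I = 0 := by linear_combination right - left - shift
  simp [Real.pi_ne_zero] at this

end Complex

/-- The **hairy ball theorem** for the 2-sphere. -/
theorem exists_eq_zero_of_tangent_sphere {v : (Fin 3 → ℝ) → Fin 3 → ℝ}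
    (hv : ContinuousOn v {x | x ⬝ᵥ x = 1}) (htan : ∀ x, x ⬝ᵥ x = 1 → x ⬝ᵥ v x = 0) :
    ∃ x, x ⬝ᵥ x = 1 ∧ v x = 0 := by
  by_contra! hne
  let P : ℝ × ℝ → Fin 3 → ℝ := fun p ↦
    ![Real.sin p.1 * Real.cos p.2, Real.sin p.1 * Real.sin p.2, Real.cos p.1]
  have hP (p) : P p ⬝ᵥ P p = 1 := by
    simp only [P, Matrix.vec3_dotProduct, Matrix.cons_val]
    linear_combination Real.sin p.1 ^ 2 * Real.sin_sq_add_cos_sq p.2 + Real.sin_sq_add_cos_sq p.1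
  have hPc : Continuous P := by
    refine continuous_pi fun i ↦ ?_
    fin_cases i <;> simp [P] <;> fun_prop
  obtain ⟨u, hu⟩ : ∃ u : ℝ × ℝ → Fin 3 → ℝ, ∀ p, u p = v (P p) := ⟨_, fun _ ↦ rfl⟩
  have huc : Continuous u := (hv.comp_continuous hPc hP).congr fun p ↦ (hu p).symm
  -- the coordinates of `v` in the moving frame of meridians and parallels
  let a : ℝ × ℝ → ℝ := fun p ↦ Real.cos p.1 * Real.cos p.2 * u p 0 +
    Real.cos p.1 * Real.sin p.2 * u p 1 - Real.sin p.1 * u p 2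
  let b : ℝ × ℝ → ℝ := fun p ↦ -Real.sin p.2 * u p 0 + Real.cos p.2 * u p 1
  have ha : Continuous a := by fun_prop
  have hb : Continuous b := by fun_prop
  refine Complex.not_exists_homotopy_exp_neg_exp (g := fun p ↦ (a p : ℂ) + b p * Complex.I)
    (s₀ := 0) (s₁ := Real.pi) (c := v ![0, 0, 1] 0 + v ![0, 0, 1] 1 * Complex.I)
    (d := -(v ![0, 0, -1] 0 - v ![0, 0, -1] 1 * Complex.I)) (by fun_prop) (fun p hp ↦ ?_)
    (fun s t ↦ by simp [a, b, hu, P]) (fun t ↦ ?_) (fun t ↦ ?_)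
  · have h₁ : a p = 0 := by simpa using congrArg Complex.re hp
    have h₂ : b p = 0 := by simpa using congrArg Complex.im hp
    have h₃ := htan _ (hP p)
    refine hne _ (hP p) ?_
    rw [← hu] at h₃ ⊢
    simp only [a, b, P, Matrix.vec3_dotProduct, Matrix.cons_val] at h₁ h₂ h₃
    have hs := Real.sin_sq_add_cos_sq p.1
    have ht := Real.sin_sq_add_cos_sq p.2
    ext i
    fin_cases i <;> simp only [Fin.zero_eta, Fin.mk_one, Fin.reduceFinMk, Pi.zero_apply]
    · linear_combination Real.sin p.1 * Real.cos p.2 * h₃ + Real.cos p.1 * Real.cos p.2 * h₁ -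
        Real.sin p.2 * h₂ - (u p 0 * Real.cos p.2 ^ 2 + u p 1 * Real.sin p.2 * Real.cos p.2) * hs -
        u p 0 * ht
    · linear_combination Real.sin p.1 * Real.sin p.2 * h₃ + Real.cos p.1 * Real.sin p.2 * h₁ +
        Real.cos p.2 * h₂ - (u p 0 * Real.sin p.2 * Real.cos p.2 + u p 1 * Real.sin p.2 ^ 2) * hs -
        u p 1 * ht
    · linear_combination Real.cos p.1 * h₃ - Real.sin p.1 * h₁ - u p 2 * hs
  · have hP₀ : P (0, t) = ![0, 0, 1] := by simp [P]
    simp only [a, b, hu, hP₀]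
    simp [Complex.ext_iff, Complex.exp_re, Complex.exp_im, Complex.cos_ofReal_re,
      Complex.sin_ofReal_re]
    constructor <;> ring
  · have hP₁ : P (Real.pi, t) = ![0, 0, -1] := by simp [P]
    simp only [a, b, hu, hP₁]
    simp [Complex.ext_iff, Complex.exp_re, Complex.exp_im, Complex.cos_ofReal_re,
      Complex.sin_ofReal_re]
    constructor <;> ring

namespace SphereRing

/-- The coordinate functions on the sphere. -/
noncomputable def coord (i : Fin 3) : SphereRing := Ideal.Quotient.mk _ (X i)

theorem sum_coord_sq : ∑ i, coord i ^ 2 = 1 := by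
  rw [← sub_eq_zero, Fin.sum_univ_three]
  exact Ideal.Quotient.eq_zero_iff_mem.mpr (Ideal.mem_span_singleton_self _)

/-- Evaluation of functions at a point of the sphere. -/
noncomputable def evalAt (x : Fin 3 → ℝ) (hx : x ⬝ᵥ x = 1) : SphereRing →ₐ[ℝ] ℝ :=
  Ideal.Quotient.liftₐ _ (aeval x) fun p hp ↦ by
    obtain ⟨q, rfl⟩ := Ideal.mem_span_singleton'.mp hp
    rw [Matrix.vec3_dotProduct] at hx
    simp only [map_mul, map_sub, map_add, map_pow, aeval_X, map_one]
    linear_combination aeval x q * hx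

theorem evalAt_mk (x : Fin 3 → ℝ) (hx : x ⬝ᵥ x = 1) (p : MvPolynomial (Fin 3) ℝ) :
    evalAt x hx (Ideal.Quotient.mk _ p) = eval x p := by
  simp [evalAt]

theorem evalAt_coord (x : Fin 3 → ℝ) (hx : x ⬝ᵥ x = 1) (i : Fin 3) :
    evalAt x hx (coord i) = x i := by
  simp [coord, evalAt_mk]

/-- A derivation is determined by its values on the coordinate functions. -/
theorem derivation_ext {δ ε : Derivation ℝ SphereRing SphereRing}
    (h : ∀ i, δ (coord i) = ε (coord i)) : δ = ε := by
  have key : δ.compAlgebraMap (MvPolynomial (Fin 3) ℝ) =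
      ε.compAlgebraMap (MvPolynomial (Fin 3) ℝ) := MvPolynomial.derivation_ext h
  ext r
  obtain ⟨p, rfl⟩ := Ideal.Quotient.mk_surjective r
  exact congr($key p)

/-- Derivations of the coordinate ring are vector fields tangent to the sphere. -/
theorem sum_coord_mul_derivation (δ : Derivation ℝ SphereRing SphereRing) :
    ∑ i, coord i * δ (coord i) = 0 := by
  have h := congrArg δ sum_coord_sq
  simp only [map_sum, Derivation.leibniz_pow, Derivation.map_one_eq_zero, Nat.add_one_sub_one,
    pow_one, smul_eq_mul, nsmul_eq_mul, ← Finset.mul_sum] at h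
  have h2 : algebraMap ℝ SphereRing 2⁻¹ * 2 = 1 := by
    rw [← map_ofNat (algebraMap ℝ SphereRing) 2, ← map_mul]
    norm_num
  push_cast at h
  linear_combination algebraMap ℝ SphereRing 2⁻¹ * h -
    (∑ i, coord i * δ (coord i)) * h2

theorem mk_mkDerivation_eq_zero (i : Fin 3) (p : MvPolynomial (Fin 3) ℝ)
    (hp : (Ideal.Quotient.mkₐ ℝ _ p : SphereRing) = 0) :
    (Ideal.Quotient.mkₐ ℝ _
      (mkDerivation ℝ (fun j ↦ Pi.single i 1 j - X i * X j) p) : SphereRing) = 0 := by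
  obtain ⟨q, rfl⟩ := Ideal.mem_span_singleton'.mp (Ideal.Quotient.eq_zero_iff_mem.mp hp)
  refine Ideal.Quotient.eq_zero_iff_mem.mpr (Ideal.mem_span_singleton.mpr ?_)
  have hd : mkDerivation ℝ (fun j : Fin 3 ↦
        (Pi.single i 1 j - X i * X j : MvPolynomial (Fin 3) ℝ))
      (X 0 ^ 2 + X 1 ^ 2 + X 2 ^ 2 - 1) = -2 * X i * (X 0 ^ 2 + X 1 ^ 2 + X 2 ^ 2 - 1) := by
    fin_cases i <;> simp [Derivation.leibniz_pow, mkDerivation_X] <;> ring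
  rw [Derivation.leibniz, hd, smul_eq_mul, smul_eq_mul]
  exact dvd_add ((dvd_mul_left _ _).mul_left _) (dvd_mul_right _ _)

/-- The orthogonal projection of the `i`-th coordinate vector field to the tangent bundle of the
sphere. -/
noncomputable def tangentProj (i : Fin 3) : Derivation ℝ SphereRing SphereRing :=
  Derivation.liftOfSurjective (Ideal.Quotient.mkₐ_surjective ℝ _) (mk_mkDerivation_eq_zero i)

theorem tangentProj_coord (i j : Fin 3) :
    tangentProj i (coord j) = (if j = i then 1 else 0) - coord i * coord j := by
  have h : tangentProj i (coord j) = _ := Derivation.liftOfSurjective_apply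
    (Ideal.Quotient.mkₐ_surjective ℝ _) (mk_mkDerivation_eq_zero i) (X j)
  rw [h, mkDerivation_X]
  rcases eq_or_ne j i with rfl | hj <;> simp [coord, *]

theorem sum_smul_tangentProj (δ : Derivation ℝ SphereRing SphereRing) :
    ∑ i, δ (coord i) • tangentProj i = δ := by
  refine derivation_ext fun j ↦ ?_
  have h := sum_coord_mul_derivation δ
  rw [Fin.sum_univ_three] at h ⊢
  simp only [Derivation.add_apply, Derivation.smul_apply, tangentProj_coord, smul_eq_mul]
  fin_cases j <;> simp
  · linear_combination -coord 0 * h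
  · linear_combination -coord 1 * h
  · linear_combination -coord 2 * h

/-- The coefficients of a derivation, as a linear map. -/
noncomputable def coeff :
    Derivation ℝ SphereRing SphereRing →ₗ[SphereRing] Fin 3 → SphereRing where
  toFun δ i := δ (coord i)
  map_add' _ _ := rfl
  map_smul' _ _ := rfl

theorem linearCombination_tangentProj_comp_coeff :
    (Fintype.linearCombination SphereRing tangentProj).comp coeff = LinearMap.id :=
  LinearMap.ext sum_smul_tangentProj

theorem tangentProj_zero_ne_zero : tangentProj 0 ≠ 0 := fun h ↦ by
  have := congrArg (evalAt ![0, 0, 1] (by simp)) congr($h (coord 0))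
  simp [tangentProj_coord, evalAt_coord] at this

/-- Every derivation of the coordinate ring of the sphere vanishes at some point. -/
theorem exists_evalAt_derivation_eq_zero (δ : Derivation ℝ SphereRing SphereRing) :
    ∃ x hx, ∀ i, evalAt x hx (δ (coord i)) = 0 := by
  choose p hp using fun i ↦ Ideal.Quotient.mk_surjective (δ (coord i))
  have h (x hx i) : evalAt x hx (δ (coord i)) = eval x (p i) := by rw [← hp, evalAt_mk]
  obtain ⟨x, hx, hv⟩ := exists_eq_zero_of_tangent_sphere (v := fun x i ↦ eval x (p i))
    (continuous_pi fun i ↦ (p i).continuous_eval).continuousOn fun x hx ↦ by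
      have := congrArg (evalAt x hx) (sum_coord_mul_derivation δ)
      simpa [evalAt_coord, h, dotProduct] using this
  exact ⟨x, hx, fun i ↦ (h x hx i).trans (congrFun hv i)⟩

theorem linearMap_apply_derivation_ne_one
    (f : Derivation ℝ SphereRing SphereRing →ₗ[SphereRing] SphereRing)
    (δ : Derivation ℝ SphereRing SphereRing) : f δ ≠ 1 := fun h ↦ by
  obtain ⟨x, hx, hδ⟩ := exists_evalAt_derivation_eq_zero δ
  rw [← sum_smul_tangentProj δ] at h
  simpa [hδ] using congrArg (evalAt x hx) h

end SphereRing

/-- For the coordinate ring `R = ℝ[X, Y, Z]/(X² + Y² + Z² − 1)` of the real 2-sphere, the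
`R`-module `Der_ℝ(R)` of `ℝ`-linear derivations is finitely generated and projective, but it is
not free (it is the module of sections of the tangent bundle of the 2-sphere). -/
theorem derivation_sphereRing_projective_not_free :
    Module.Finite SphereRing (Derivation ℝ SphereRing SphereRing) ∧
      Module.Projective SphereRing (Derivation ℝ SphereRing SphereRing) ∧
        ¬ Module.Free SphereRing (Derivation ℝ SphereRing SphereRing) := by
  have split := SphereRing.linearCombination_tangentProj_comp_coeff
  refine ⟨.of_surjective _ (LinearMap.surjective_of_comp_eq_id _ _ split),
    .of_split _ _ split, fun _ ↦ ?_⟩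
  let b := Module.Free.chooseBasis SphereRing (Derivation ℝ SphereRing SphereRing)
  have : Nontrivial (Derivation ℝ SphereRing SphereRing) :=
    ⟨_, _, SphereRing.tangentProj_zero_ne_zero⟩
  obtain ⟨i⟩ := b.index_nonempty
  exact SphereRing.linearMap_apply_derivation_ne_one (b.coord i) (b i) (by simp)
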